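/- With the sum taken over the 56 vectors v ∈ W·ρ satisfying ⟨v,γi⟩ > 0 for all 1 ≤ i ≤ 6, one has Σ_v Π_{α∈Δ⁺(k)} (⟨v,α⟩ / ⟨ρ_c,α⟩) = 2^{27}. (Each product is the Weyl dimension of the k-type with highest weight v − ρ_c; the identity expresses the decomposition of the 2^{27}-dimensional spin module S_G = ⊕_{j=0}^{55} E_{ρ_n^{(j)}} for E7(−25).) -/

import Mathlib

open scoped BigOperators

namespace E7

noncomputable section

/-- The standard inner product on ℝ⁸. -/
def ip (x y : Fin 8 → ℝ) : ℝ := ∑ i, x i * y i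

/-- The simple roots α₁,…,α₇ of E₇ (indexed by `Fin 7`). -/
def sroot : Fin 7 → Fin 8 → ℝ :=
  ![![1/2, -1/2, -1/2, -1/2, -1/2, -1/2, -1/2, 1/2],
    ![1, 1, 0, 0, 0, 0, 0, 0],
    ![-1, 1, 0, 0, 0, 0, 0, 0],
    ![0, -1, 1, 0, 0, 0, 0, 0],
    ![0, 0, -1, 1, 0, 0, 0, 0],
    ![0, 0, 0, -1, 1, 0, 0, 0],
    ![0, 0, 0, 0, -1, 1, 0, 0]]

/-- The root lattice `Q`: integer linear combinations of the simple roots. -/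
def latQ : Set (Fin 8 → ℝ) := {v | ∃ c : Fin 7 → ℤ, v = ∑ j, (c j : ℝ) • sroot j}

/-- The E₇ root system `Φ = {v ∈ Q : ⟨v,v⟩ = 2}`. -/
def Phi : Set (Fin 8 → ℝ) := {v | v ∈ latQ ∧ ip v v = 2}

/-- The vector ζ. -/
def zeta : Fin 8 → ℝ := ![0, 0, 0, 0, 0, 1, -1/2, 1/2]

/-- The positive roots Δ⁺: roots that are nonnegative integer combinations
of the simple roots. -/
def PhiPos : Set (Fin 8 → ℝ) :=
  {v | v ∈ Phi ∧ ∃ c : Fin 7 → ℕ, v = ∑ j, (c j : ℝ) • sroot j}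

/-- The compact positive roots Δ⁺(k) = {α ∈ Δ⁺ : ⟨α,ζ⟩ = 0}. -/
def PhiPosK : Set (Fin 8 → ℝ) := {v | v ∈ PhiPos ∧ ip v zeta = 0}

/-- The Weyl group `W` of E₇: the subgroup of linear automorphisms of ℝ⁸
generated by the reflections `s_α : v ↦ v − ⟨v,α⟩α` for `α ∈ Φ`. -/
def W : Subgroup ((Fin 8 → ℝ) ≃ₗ[ℝ] (Fin 8 → ℝ)) :=
  Subgroup.closure {g | ∃ a ∈ Phi, ∀ v, g v = v - ip v a • a}

/-- The subgroup of `W` generated by the six compact simple reflections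
`s_{γ₁},…,s_{γ₆}` (the Weyl group of E₆, i.e. of k). -/
def WK : Subgroup ((Fin 8 → ℝ) ≃ₗ[ℝ] (Fin 8 → ℝ)) :=
  Subgroup.closure
    {g | ∃ i : Fin 6, ∀ v, g v = v - ip v (sroot i.castSucc) • sroot i.castSucc}

end

/-- The bilinear form on `ℤ⁷` given by the Cartan matrix of `E₇`. -/
def cartanForm (c d : Fin 7 → ℤ) : ℤ :=
  c 0 * (2 * d 0 - d 2) + c 1 * (2 * d 1 - d 3) + c 2 * (2 * d 2 - d 0 - d 3) +
    c 3 * (2 * d 3 - d 1 - d 2 - d 4) + c 4 * (2 * d 4 - d 3 - d 5) +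
    c 5 * (2 * d 5 - d 4 - d 6) + c 6 * (2 * d 6 - d 5)

/-- The positive roots in coordinates with respect to the simple roots, by increasing height. -/
def posRoots : List (Fin 7 → ℤ) :=
  [
    ![1, 0, 0, 0, 0, 0, 0],
    ![0, 1, 0, 0, 0, 0, 0],
    ![0, 0, 1, 0, 0, 0, 0],
    ![0, 0, 0, 1, 0, 0, 0],
    ![0, 0, 0, 0, 1, 0, 0],
    ![0, 0, 0, 0, 0, 1, 0],
    ![0, 0, 0, 0, 0, 0, 1],
    ![1, 0, 1, 0, 0, 0, 0],
    ![0, 1, 0, 1, 0, 0, 0],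
    ![0, 0, 1, 1, 0, 0, 0],
    ![0, 0, 0, 1, 1, 0, 0],
    ![0, 0, 0, 0, 1, 1, 0],
    ![0, 0, 0, 0, 0, 1, 1],
    ![1, 0, 1, 1, 0, 0, 0],
    ![0, 1, 1, 1, 0, 0, 0],
    ![0, 1, 0, 1, 1, 0, 0],
    ![0, 0, 1, 1, 1, 0, 0],
    ![0, 0, 0, 1, 1, 1, 0],
    ![0, 0, 0, 0, 1, 1, 1],
    ![1, 1, 1, 1, 0, 0, 0],
    ![1, 0, 1, 1, 1, 0, 0],
    ![0, 1, 1, 1, 1, 0, 0],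
    ![0, 1, 0, 1, 1, 1, 0],
    ![0, 0, 1, 1, 1, 1, 0],
    ![0, 0, 0, 1, 1, 1, 1],
    ![1, 1, 1, 1, 1, 0, 0],
    ![1, 0, 1, 1, 1, 1, 0],
    ![0, 1, 1, 2, 1, 0, 0],
    ![0, 1, 1, 1, 1, 1, 0],
    ![0, 1, 0, 1, 1, 1, 1],
    ![0, 0, 1, 1, 1, 1, 1],
    ![1, 1, 1, 2, 1, 0, 0],
    ![1, 1, 1, 1, 1, 1, 0],
    ![1, 0, 1, 1, 1, 1, 1],
    ![0, 1, 1, 2, 1, 1, 0],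
    ![0, 1, 1, 1, 1, 1, 1],
    ![1, 1, 2, 2, 1, 0, 0],
    ![1, 1, 1, 2, 1, 1, 0],
    ![1, 1, 1, 1, 1, 1, 1],
    ![0, 1, 1, 2, 2, 1, 0],
    ![0, 1, 1, 2, 1, 1, 1],
    ![1, 1, 2, 2, 1, 1, 0],
    ![1, 1, 1, 2, 2, 1, 0],
    ![1, 1, 1, 2, 1, 1, 1],
    ![0, 1, 1, 2, 2, 1, 1],
    ![1, 1, 2, 2, 2, 1, 0],
    ![1, 1, 2, 2, 1, 1, 1],
    ![1, 1, 1, 2, 2, 1, 1],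
    ![0, 1, 1, 2, 2, 2, 1],
    ![1, 1, 2, 3, 2, 1, 0],
    ![1, 1, 2, 2, 2, 1, 1],
    ![1, 1, 1, 2, 2, 2, 1],
    ![1, 2, 2, 3, 2, 1, 0],
    ![1, 1, 2, 3, 2, 1, 1],
    ![1, 1, 2, 2, 2, 2, 1],
    ![1, 2, 2, 3, 2, 1, 1],
    ![1, 1, 2, 3, 2, 2, 1],
    ![1, 2, 2, 3, 2, 2, 1],
    ![1, 1, 2, 3, 3, 2, 1],
    ![1, 2, 2, 3, 3, 2, 1],
    ![1, 2, 2, 4, 3, 2, 1],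
    ![1, 2, 3, 4, 3, 2, 1],
    ![2, 2, 3, 4, 3, 2, 1]]

/-- The compact positive roots in simple-root coordinates. -/
def compactPosRoots : List (Fin 7 → ℤ) := posRoots.filter fun c => c 6 = 0

/-- The `k`-th positive root for `k > 0`, and the negative of the `(-k)`-th one for `k < 0`. -/
def signedRoot (k : ℤ) : Fin 7 → ℤ :=
  if 0 < k then posRoots.getD (k.toNat - 1) 0 else -posRoots.getD ((-k).toNat - 1) 0

/-- The sum `2ρ` of the positive roots in simple-root coordinates. -/
def twoRho : Fin 7 → ℤ := ![34, 49, 66, 96, 75, 52, 27]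

/-- The simple systems of the 56 Weyl chambers contained in the dominant chamber of `Δ⁺(k)`,
each given by its signed root indices. -/
def chambers : List (Fin 7 → ℤ) :=
  [
    ![1, 2, 3, 4, 5, 6, 7],
    ![1, 2, 3, 4, 5, 13, -7],
    ![1, 2, 3, 4, 19, -13, 6],
    ![1, 2, 3, 25, -19, 5, 6],
    ![1, 30, 31, -25, 4, 5, 6],
    ![1, -30, 31, 2, 4, 5, 6],
    ![34, 30, -31, 3, 4, 5, 6],
    ![34, -30, -31, 36, 4, 5, 6],
    ![-34, 30, 1, 3, 4, 5, 6],
    ![-34, -30, 1, 36, 4, 5, 6],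
    ![34, 3, 2, -36, 41, 5, 6],
    ![-34, 3, 39, -36, 41, 5, 6],
    ![34, 3, 2, 4, -41, 45, 6],
    ![2, 3, -39, 1, 41, 5, 6],
    ![-34, 3, 39, 4, -41, 45, 6],
    ![34, 3, 2, 4, 5, -45, 49],
    ![2, 3, -39, 44, -41, 45, 6],
    ![-34, 3, 39, 4, 5, -45, 49],
    ![34, 3, 2, 4, 5, 6, -49],
    ![2, 47, 4, -44, 1, 45, 6],
    ![2, 3, -39, 44, 5, -45, 49],
    ![-34, 3, 39, 4, 5, 6, -49],
    ![2, -47, 4, 3, 1, 45, 6],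
    ![2, 47, 4, -44, 48, -45, 49],
    ![2, 3, -39, 44, 5, 6, -49],
    ![2, -47, 4, 3, 48, -45, 49],
    ![2, 47, 4, 5, -48, 1, 49],
    ![2, 47, 4, -44, 48, 6, -49],
    ![2, -47, 4, 51, -48, 1, 49],
    ![2, -47, 4, 3, 48, 6, -49],
    ![2, 47, 4, 5, -48, 52, -49],
    ![2, 5, 54, -51, 3, 1, 49],
    ![2, -47, 4, 51, -48, 52, -49],
    ![2, 47, 4, 5, 6, -52, 1],
    ![56, 5, -54, 4, 3, 1, 49],
    ![2, 5, 54, -51, 3, 52, -49],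
    ![2, -47, 4, 51, 6, -52, 1],
    ![-56, 5, 2, 4, 3, 1, 49],
    ![56, 5, -54, 4, 3, 52, -49],
    ![2, 5, 54, -51, 55, -52, 1],
    ![-56, 5, 2, 4, 3, 52, -49],
    ![56, 5, -54, 4, 55, -52, 1],
    ![2, 5, 54, 6, -55, 3, 1],
    ![-56, 5, 2, 4, 55, -52, 1],
    ![56, 5, -54, 57, -55, 3, 1],
    ![-56, 5, 2, 57, -55, 3, 1],
    ![56, 59, 6, -57, 4, 3, 1],
    ![-56, 59, 58, -57, 4, 3, 1],
    ![56, -59, 6, 5, 4, 3, 1],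
    ![-56, -59, 58, 5, 4, 3, 1],
    ![6, 59, -58, 2, 4, 3, 1],
    ![6, -59, -58, 60, 4, 3, 1],
    ![6, 2, 5, -60, 61, 3, 1],
    ![6, 2, 5, 4, -61, 62, 1],
    ![6, 2, 5, 4, 3, -62, 63],
    ![6, 2, 5, 4, 3, 1, -63]]

/-- Twice the half sum of positive roots of the positive system with simple roots `k`. -/
def chamberTwoRho (k : Fin 7 → ℤ) : Fin 7 → ℤ :=
  34 • signedRoot (k 0) + 49 • signedRoot (k 1) + 66 • signedRoot (k 2) + 96 • signedRoot (k 3) +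
    75 • signedRoot (k 4) + 52 • signedRoot (k 5) + 27 • signedRoot (k 6)

/-- The 56 vectors `2v`, in simple-root coordinates. -/
def spinWeights : List (Fin 7 → ℤ) := chambers.map chamberTwoRho

set_option maxRecDepth 100000 in
theorem nodup_posRoots : posRoots.Nodup := by decide +kernel

theorem sum_posRoots : posRoots.sum = twoRho := by decide +kernel

theorem nodup_spinWeights : spinWeights.Nodup := by decide +kernel

theorem posRoots_spec : ∀ c ∈ posRoots, cartanForm c c = 2 ∧ ∀ i, 0 ≤ c i := by decide +kernel

theorem cartanForm_signedRoot :
    ∀ k ∈ chambers, ∀ j, cartanForm (signedRoot (k j)) (signedRoot (k j)) = 2 := by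
  decide +kernel

theorem cartanForm_self_spinWeights : ∀ u ∈ spinWeights, cartanForm u u = 798 := by
  decide +kernel

theorem spinWeights_dominant :
    ∀ u ∈ spinWeights, ∀ i : Fin 6, 0 < cartanForm u (Pi.single i.castSucc 1) := by
  decide +kernel

theorem signedRoot_compact_or_mem : ∀ k ∈ chambers, ∀ j,
    (signedRoot (k j) 6 = 0 ∧ ∀ i, 0 ≤ signedRoot (k j) i) ∨
      chamberTwoRho k - 2 • signedRoot (k j) ∈ spinWeights := by
  decide +kernel

theorem chamber_eq_or_exists_neg : ∀ k ∈ chambers, chamberTwoRho k = twoRho ∨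
    ∃ j, cartanForm (signedRoot (k j)) twoRho < 0 ∧
      chamberTwoRho k - 2 • signedRoot (k j) ∈ spinWeights ∧
      cartanForm (chamberTwoRho k) (signedRoot (k j)) = 2 := by
  decide +kernel

theorem sum_prod_spinWeights :
    (spinWeights.map fun u => (compactPosRoots.map (cartanForm u)).prod).sum =
      2 ^ 27 * (compactPosRoots.map (cartanForm compactPosRoots.sum)).prod := by
  decide +kernel

theorem prod_compact_ne_zero :
    (compactPosRoots.map (cartanForm compactPosRoots.sum)).prod ≠ 0 := by
  decide +kernel

theorem mem_posRoots_of_mem_box :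
    ∀ a ∈ [(0 : ℤ), 1, 2], ∀ b ∈ [(0 : ℤ), 1, 2], ∀ c ∈ [(0 : ℤ), 1, 2, 3],
      ∀ d ∈ [(0 : ℤ), 1, 2, 3, 4], ∀ e ∈ [(0 : ℤ), 1, 2, 3], ∀ f ∈ [(0 : ℤ), 1, 2],
      ∀ g ∈ [(0 : ℤ), 1], cartanForm ![a, b, c, d, e, f, g] ![a, b, c, d, e, f, g] = 2 →
        ![a, b, c, d, e, f, g] ∈ posRoots := by
  decide +kernel

theorem sq_le_cartanForm (c : Fin 7 → ℤ) :
    c 0 ^ 2 ≤ 2 * cartanForm c c ∧ 2 * c 1 ^ 2 ≤ 7 * cartanForm c c ∧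
      c 2 ^ 2 ≤ 6 * cartanForm c c ∧ c 3 ^ 2 ≤ 12 * cartanForm c c ∧
      2 * c 4 ^ 2 ≤ 15 * cartanForm c c ∧ c 5 ^ 2 ≤ 4 * cartanForm c c ∧
      2 * c 6 ^ 2 ≤ 3 * cartanForm c c := by
  simp only [cartanForm]
  refine ⟨?_, ?_, ?_, ?_, ?_, ?_, ?_⟩
  · nlinarith only [sq_nonneg (2 * c 1 - c 3),
      sq_nonneg (-c 0 + 2 * c 2 - c 3),
      sq_nonneg (-c 0 + 2 * c 3 - 2 * c 4),
      sq_nonneg (-c 0 + 2 * c 4 - 2 * c 5),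
      sq_nonneg (-c 0 + 2 * c 5 - 2 * c 6),
      sq_nonneg (-c 0 + 2 * c 6)]
  · nlinarith only [sq_nonneg (2 * c 0 - c 2),
      sq_nonneg (3 * c 2 - 2 * c 3),
      sq_nonneg ((-3) * c 1 + 4 * c 3 - 3 * c 4),
      sq_nonneg ((-3) * c 1 + 5 * c 4 - 4 * c 5),
      sq_nonneg ((-3) * c 1 + 6 * c 5 - 5 * c 6),
      sq_nonneg ((-3) * c 1 + 7 * c 6)]
  · nlinarith only [sq_nonneg (2 * c 0 - c 2),
      sq_nonneg (2 * c 1 - c 3),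
      sq_nonneg ((-2) * c 2 + 3 * c 3 - 2 * c 4),
      sq_nonneg ((-2) * c 2 + 4 * c 4 - 3 * c 5),
      sq_nonneg ((-2) * c 2 + 5 * c 5 - 4 * c 6),
      sq_nonneg (-c 2 + 3 * c 6)]
  · nlinarith only [sq_nonneg (2 * c 0 - c 2),
      sq_nonneg (2 * c 1 - c 3),
      sq_nonneg (3 * c 2 - 2 * c 3),
      sq_nonneg (-c 3 + 2 * c 4 - c 5),
      sq_nonneg (-c 3 + 3 * c 5 - 2 * c 6),
      sq_nonneg (-c 3 + 4 * c 6)]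
  · nlinarith only [sq_nonneg (2 * c 0 - c 2),
      sq_nonneg (2 * c 1 - c 3),
      sq_nonneg (3 * c 2 - 2 * c 3),
      sq_nonneg (5 * c 3 - 6 * c 4),
      sq_nonneg (-c 4 + 2 * c 5 - c 6),
      sq_nonneg (-c 4 + 3 * c 6)]
  · nlinarith only [sq_nonneg (2 * c 0 - c 2),
      sq_nonneg (2 * c 1 - c 3),
      sq_nonneg (3 * c 2 - 2 * c 3),
      sq_nonneg (5 * c 3 - 6 * c 4),
      sq_nonneg (4 * c 4 - 5 * c 5),
      sq_nonneg (-c 5 + 2 * c 6)]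
  · nlinarith only [sq_nonneg (2 * c 0 - c 2),
      sq_nonneg (2 * c 1 - c 3),
      sq_nonneg (3 * c 2 - 2 * c 3),
      sq_nonneg (5 * c 3 - 6 * c 4),
      sq_nonneg (4 * c 4 - 5 * c 5),
      sq_nonneg (3 * c 5 - 4 * c 6)]

theorem cartanForm_comm (c d : Fin 7 → ℤ) : cartanForm c d = cartanForm d c := by
  simp only [cartanForm]; ring

theorem cartanForm_sub_zsmul_self (c d : Fin 7 → ℤ) (n : ℤ) :
    cartanForm (c - n • d) (c - n • d) =
      cartanForm c c - 2 * n * cartanForm c d + n ^ 2 * cartanForm d d := by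
  simp only [cartanForm, Pi.sub_apply, Pi.smul_apply, smul_eq_mul]; ring

theorem cartanForm_sub_zsmul_right (c d e : Fin 7 → ℤ) (n : ℤ) :
    cartanForm c (d - n • e) = cartanForm c d - n * cartanForm c e := by
  simp only [cartanForm, Pi.sub_apply, Pi.smul_apply, smul_eq_mul]; ring

theorem cartanForm_eq_sum (c d : Fin 7 → ℤ) :
    cartanForm c d = ∑ i, d i * cartanForm c (Pi.single i 1) := by
  simp [cartanForm, Fin.sum_univ_seven, Pi.single_apply]; ring

theorem cartanForm_chamberTwoRho (c k : Fin 7 → ℤ) :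
    cartanForm c (chamberTwoRho k) =
      34 * cartanForm c (signedRoot (k 0)) + 49 * cartanForm c (signedRoot (k 1)) +
        66 * cartanForm c (signedRoot (k 2)) + 96 * cartanForm c (signedRoot (k 3)) +
        75 * cartanForm c (signedRoot (k 4)) + 52 * cartanForm c (signedRoot (k 5)) +
        27 * cartanForm c (signedRoot (k 6)) := by
  simp only [cartanForm, chamberTwoRho, Pi.add_apply, Pi.smul_apply, Int.nsmul_eq_mul]
  push_cast
  ring

theorem cartanForm_twoRho (d : Fin 7 → ℤ) : cartanForm d twoRho = 2 * ∑ i, d i := by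
  simp [cartanForm, twoRho, Fin.sum_univ_seven]; ring

theorem even_cartanForm_self (c : Fin 7 → ℤ) : Even (cartanForm c c) :=
  ⟨c 0 * (c 0 - c 2) + c 1 * (c 1 - c 3) + c 2 * (c 2 - c 3) + c 3 * (c 3 - c 4) +
    c 4 * (c 4 - c 5) + c 5 * (c 5 - c 6) + c 6 ^ 2, by simp only [cartanForm]; ring⟩

theorem eq_zero_of_cartanForm_self_nonpos {c : Fin 7 → ℤ} (h : cartanForm c c ≤ 0) : c = 0 := by
  obtain ⟨h0, h1, h2, h3, h4, h5, h6⟩ := sq_le_cartanForm c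
  funext i
  refine pow_eq_zero_iff two_ne_zero |>.mp (le_antisymm ?_ (sq_nonneg (c i)))
  fin_cases i <;> simp only [Fin.zero_eta, Fin.mk_one, Fin.reduceFinMk] <;> linarith

theorem two_le_cartanForm_self {c : Fin 7 → ℤ} (h : c ≠ 0) : 2 ≤ cartanForm c c := by
  have h0 : 0 < cartanForm c c := by
    by_contra! h'
    exact h (eq_zero_of_cartanForm_self_nonpos h')
  obtain ⟨n, hn⟩ := even_cartanForm_self c
  omega

theorem cartanForm_nonpos_of_disjoint {p q : Fin 7 → ℤ} (hp : ∀ i, 0 ≤ p i) (hq : ∀ i, 0 ≤ q i)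
    (h : ∀ i, p i * q i = 0) : cartanForm p q ≤ 0 := by
  have hpq i j : 0 ≤ p i * q j := mul_nonneg (hp i) (hq j)
  simp only [cartanForm]
  linarith [h 0, h 1, h 2, h 3, h 4, h 5, h 6, hpq 0 2, hpq 1 3, hpq 2 0, hpq 2 3, hpq 3 1,
    hpq 3 2, hpq 3 4, hpq 4 3, hpq 4 5, hpq 5 4, hpq 5 6, hpq 6 5]

/-- The coordinates of a root are all nonnegative or all nonpositive. -/
theorem nonneg_or_nonpos_of_root {c : Fin 7 → ℤ} (hc : cartanForm c c = 2) :
    (∀ i, 0 ≤ c i) ∨ ∀ i, c i ≤ 0 := by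
  set p : Fin 7 → ℤ := fun i => max (c i) 0 with hp
  set q : Fin 7 → ℤ := fun i => max (-c i) 0 with hq
  have hcpq : c = p - (1 : ℤ) • q := by
    funext i; simp only [hp, hq, Pi.sub_apply, one_smul]; omega
  have hpq : cartanForm p q ≤ 0 := by
    refine cartanForm_nonpos_of_disjoint (fun i => le_max_right _ _) (fun i => le_max_right _ _)
      fun i => ?_
    rcases le_total (c i) 0 with h | h
    · simp [hp, h]
    · simp [hq, h]
  have key : cartanForm c c = cartanForm p p - 2 * cartanForm p q + cartanForm q q := by
    conv_lhs => rw [hcpq]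
    rw [cartanForm_sub_zsmul_self]; ring
  by_cases hp0 : p = 0
  · right
    intro i
    have := congrFun hp0 i
    simp only [hp, Pi.zero_apply] at this
    omega
  by_cases hq0 : q = 0
  · left
    intro i
    have := congrFun hq0 i
    simp only [hq, Pi.zero_apply] at this
    omega
  have := two_le_cartanForm_self hp0
  have := two_le_cartanForm_self hq0
  omega

theorem two_le_abs_cartanForm_twoRho {d : Fin 7 → ℤ} (hd : cartanForm d d = 2) :
    2 ≤ |cartanForm d twoRho| := by
  have hne : cartanForm d twoRho ≠ 0 := by
    intro h0
    rw [cartanForm_twoRho] at h0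
    have hs : ∑ i, d i = 0 := by omega
    have hd0 : d = 0 := by
      rcases nonneg_or_nonpos_of_root hd with h | h
      · funext i
        exact (Finset.sum_eq_zero_iff_of_nonneg fun i _ => h i).mp hs i (Finset.mem_univ i)
      · funext i
        exact (Finset.sum_eq_zero_iff_of_nonpos fun i _ => h i).mp hs i (Finset.mem_univ i)
    simp [hd0, cartanForm] at hd
  rw [cartanForm_twoRho] at hne ⊢
  rw [abs_mul, abs_two]
  have : 0 < |∑ i, d i| := abs_pos.mpr (right_ne_zero_of_mul hne)
  omega

theorem mem_posRoots_iff {c : Fin 7 → ℤ} :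
    c ∈ posRoots ↔ cartanForm c c = 2 ∧ ∀ i, 0 ≤ c i := by
  refine ⟨posRoots_spec c, fun ⟨hc, hpos⟩ => ?_⟩
  obtain ⟨h0, h1, h2, h3, h4, h5, h6⟩ := sq_le_cartanForm c
  rw [hc] at h0 h1 h2 h3 h4 h5 h6
  have b0 : c 0 ≤ 2 := by nlinarith
  have b1 : c 1 ≤ 2 := by nlinarith
  have b2 : c 2 ≤ 3 := by nlinarith
  have b3 : c 3 ≤ 4 := by nlinarith
  have b4 : c 4 ≤ 3 := by nlinarith
  have b5 : c 5 ≤ 2 := by nlinarith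
  have b6 : c 6 ≤ 1 := by nlinarith
  have e : c = ![c 0, c 1, c 2, c 3, c 4, c 5, c 6] := by
    funext i; fin_cases i <;> rfl
  rw [e] at hc ⊢
  refine mem_posRoots_of_mem_box _ ?_ _ ?_ _ ?_ _ ?_ _ ?_ _ ?_ _ ?_ hc <;>
    simp only [List.mem_cons, List.not_mem_nil, or_false]
  · have := hpos 0; omega
  · have := hpos 1; omega
  · have := hpos 2; omega
  · have := hpos 3; omega
  · have := hpos 4; omega
  · have := hpos 5; omega
  · have := hpos 6; omega

/-- A regular vector of the length of `2ρ` that is dominant for `Δ⁺(k)` is one of the 56. -/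
theorem mem_spinWeights {c : Fin 7 → ℤ} (hc : cartanForm c c = 798)
    (hreg : ∀ d, cartanForm d d = 2 → 2 ≤ |cartanForm c d|)
    (hdom : ∀ i : Fin 6, 0 < cartanForm c (Pi.single i.castSucc 1)) : c ∈ spinWeights := by
  obtain ⟨u, hu, hmax⟩ := spinWeights.toFinset.exists_max_image (cartanForm c)
    ⟨chamberTwoRho ![1, 2, 3, 4, 5, 6, 7],
      List.mem_toFinset.mpr (List.mem_map_of_mem List.mem_cons_self)⟩
  simp only [List.mem_toFinset] at hu hmax
  obtain ⟨k, hk, rfl⟩ := List.mem_map.mp hu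
  have hsimple (j : Fin 7) : 2 ≤ cartanForm c (signedRoot (k j)) := by
    have hnonneg : 0 ≤ cartanForm c (signedRoot (k j)) := by
      rcases signedRoot_compact_or_mem k hk j with ⟨h6, hpos⟩ | hmem
      · rw [cartanForm_eq_sum, Fin.sum_univ_castSucc]
        refine add_nonneg (Finset.sum_nonneg fun i _ => mul_nonneg (hpos _) (hdom i).le) ?_
        rw [show Fin.last 6 = 6 from rfl, h6, zero_mul]
      · have := hmax _ hmem
        rw [← natCast_zsmul, cartanForm_sub_zsmul_right] at this
        push_cast at this
        linarith
    have := hreg _ (cartanForm_signedRoot k hk j)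
    rwa [abs_of_nonneg hnonneg] at this
  have hle : 798 ≤ cartanForm c (chamberTwoRho k) := by
    rw [cartanForm_chamberTwoRho]
    linarith [hsimple 0, hsimple 1, hsimple 2, hsimple 3, hsimple 4, hsimple 5, hsimple 6]
  have hzero : c - (1 : ℤ) • chamberTwoRho k = 0 := by
    apply eq_zero_of_cartanForm_self_nonpos
    rw [cartanForm_sub_zsmul_self, hc, cartanForm_self_spinWeights _ hu]
    linarith
  rw [one_smul, sub_eq_zero] at hzero
  rwa [hzero]

noncomputable section

/-- The vector with the given simple-root coordinates. -/
def ofCoords : (Fin 7 → ℤ) →+ (Fin 8 → ℝ) where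
  toFun c := ∑ j, (c j : ℝ) • sroot j
  map_zero' := by simp
  map_add' c d := by simp [add_smul, Finset.sum_add_distrib]

theorem ofCoords_apply (c : Fin 7 → ℤ) : ofCoords c = ∑ j, (c j : ℝ) • sroot j := rfl

theorem ip_comm (x y : Fin 8 → ℝ) : ip x y = ip y x := by
  simp only [ip, mul_comm]

theorem ip_sub_right (x y z : Fin 8 → ℝ) : ip x (y - z) = ip x y - ip x z := by
  simp [ip, mul_sub]

theorem ip_smul_right (r : ℝ) (x y : Fin 8 → ℝ) : ip x (r • y) = r * ip x y := by
  simp [ip, Finset.mul_sum, mul_left_comm]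

theorem ip_sub_left (x y z : Fin 8 → ℝ) : ip (x - y) z = ip x z - ip y z := by
  rw [ip_comm, ip_sub_right, ip_comm z, ip_comm z]

theorem ip_smul_left (r : ℝ) (x y : Fin 8 → ℝ) : ip (r • x) y = r * ip x y := by
  rw [ip_comm, ip_smul_right, ip_comm]

theorem ip_ofCoords (c d : Fin 7 → ℤ) : ip (ofCoords c) (ofCoords d) = cartanForm c d := by
  simp [ip, ofCoords_apply, sroot, cartanForm, Fin.sum_univ_succ]
  ring

theorem ip_ofCoords_zeta (c : Fin 7 → ℤ) : ip (ofCoords c) zeta = c 6 := by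
  simp [ip, ofCoords_apply, sroot, zeta, Fin.sum_univ_succ]
  ring

theorem ofCoords_single (j : Fin 7) : ofCoords (Pi.single j 1) = sroot j := by
  simp [ofCoords_apply, Pi.single_apply]

theorem ofCoords_injective : Function.Injective ofCoords := by
  rw [injective_iff_map_eq_zero]
  intro c hc
  apply eq_zero_of_cartanForm_self_nonpos
  have h := ip_ofCoords c c
  rw [hc] at h
  simp only [ip, Pi.zero_apply, mul_zero, Finset.sum_const_zero] at h
  exact_mod_cast h.ge

theorem mem_latQ_iff {v : Fin 8 → ℝ} : v ∈ latQ ↔ ∃ c, v = ofCoords c := Iff.rfl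

theorem mem_Phi_iff {v : Fin 8 → ℝ} : v ∈ Phi ↔ ∃ c, v = ofCoords c ∧ cartanForm c c = 2 := by
  constructor
  · rintro ⟨⟨c, rfl⟩, h⟩
    refine ⟨c, rfl, ?_⟩
    rw [← ofCoords_apply, ip_ofCoords] at h
    exact_mod_cast h
  · rintro ⟨c, rfl, h⟩
    refine ⟨⟨c, rfl⟩, ?_⟩
    rw [ip_ofCoords, h]
    norm_num

theorem mem_PhiPos_iff {v : Fin 8 → ℝ} : v ∈ PhiPos ↔ ∃ c ∈ posRoots, v = ofCoords c := by
  constructor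
  · rintro ⟨hv, n, hn⟩
    obtain ⟨c, rfl, hc⟩ := mem_Phi_iff.mp hv
    have hcn : c = fun j => (n j : ℤ) := by
      apply ofCoords_injective
      rw [hn, ofCoords_apply]
      simp
    refine ⟨c, mem_posRoots_iff.mpr ⟨hc, fun i => ?_⟩, rfl⟩
    rw [hcn]
    positivity
  · rintro ⟨c, hc, rfl⟩
    obtain ⟨hc2, hpos⟩ := mem_posRoots_iff.mp hc
    refine ⟨mem_Phi_iff.mpr ⟨c, rfl, hc2⟩, fun j => (c j).toNat, ?_⟩
    rw [ofCoords_apply]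
    refine Finset.sum_congr rfl fun j _ => ?_
    congr 1
    exact_mod_cast (Int.toNat_of_nonneg (hpos j)).symm

theorem mem_PhiPosK_iff {v : Fin 8 → ℝ} :
    v ∈ PhiPosK ↔ ∃ c ∈ compactPosRoots, v = ofCoords c := by
  simp only [PhiPosK, Set.mem_ofPred_eq, mem_PhiPos_iff, compactPosRoots, List.mem_filter,
    decide_eq_true_eq]
  constructor
  · rintro ⟨⟨c, hc, rfl⟩, h⟩
    rw [ip_ofCoords_zeta] at h
    exact ⟨c, ⟨hc, by exact_mod_cast h⟩, rfl⟩
  · rintro ⟨c, ⟨hc, h⟩, rfl⟩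
    exact ⟨⟨c, hc, rfl⟩, by rw [ip_ofCoords_zeta, h, Int.cast_zero]⟩

theorem W_preserves {g : (Fin 8 → ℝ) ≃ₗ[ℝ] (Fin 8 → ℝ)} (hg : g ∈ W) :
    (∀ x y, ip (g x) (g y) = ip x y) ∧ ∀ x, g x ∈ latQ ↔ x ∈ latQ := by
  induction hg using Subgroup.closure_induction with
  | mem g hg =>
    obtain ⟨a, ha, hg⟩ := hg
    obtain ⟨d, rfl, hd⟩ := mem_Phi_iff.mp ha
    have hd' : ip (ofCoords d) (ofCoords d) = 2 := by rw [ip_ofCoords, hd]; norm_num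
    have hmaps x (hx : x ∈ latQ) : g x ∈ latQ := by
      obtain ⟨c, rfl⟩ := mem_latQ_iff.mp hx
      refine mem_latQ_iff.mpr ⟨c - cartanForm c d • d, ?_⟩
      rw [hg, ip_ofCoords, map_sub, map_zsmul, Int.cast_smul_eq_zsmul]
    have hinv x : g (g x) = x := by
      rw [hg (g x), hg x, ip_sub_left, ip_smul_left, hd']
      module
    refine ⟨fun x y => ?_, fun x => ⟨fun h => ?_, hmaps x⟩⟩
    · rw [hg, hg]
      simp only [ip_sub_left, ip_sub_right, ip_smul_left, ip_smul_right, hd']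
      rw [ip_comm (ofCoords d) y]
      ring
    · rw [← hinv x]
      exact hmaps _ h
  | one => simp
  | mul g h _ _ ihg ihh =>
    exact ⟨fun x y => by rw [LinearEquiv.mul_apply, LinearEquiv.mul_apply, ihg.1, ihh.1],
      fun x => by rw [LinearEquiv.mul_apply, ihg.2, ihh.2]⟩
  | inv g _ ih =>
    have hinv x : g (g⁻¹ x) = x := by rw [← LinearEquiv.mul_apply, mul_inv_cancel]; rfl
    exact ⟨fun x y => by rw [← ih.1, hinv, hinv], fun x => by rw [← ih.2, hinv]⟩

theorem exists_reflection_mem_W {d : Fin 7 → ℤ} (hd : cartanForm d d = 2) :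
    ∃ g ∈ W, ∀ v, g v = v - ip v (ofCoords d) • ofCoords d := by
  let f : Module.Dual ℝ (Fin 8 → ℝ) :=
    { toFun := fun v => ip v (ofCoords d)
      map_add' := fun x y => by simp [ip, add_mul, Finset.sum_add_distrib]
      map_smul' := fun r x => ip_smul_left r x _ }
  have hf : f (ofCoords d) = 2 := by
    change ip (ofCoords d) (ofCoords d) = 2
    rw [ip_ofCoords, hd]; norm_num
  have hg v : Module.reflection hf v = v - ip v (ofCoords d) • ofCoords d :=
    Module.reflection_apply v hf
  exact ⟨Module.reflection hf,
    Subgroup.subset_closure ⟨ofCoords d, mem_Phi_iff.mpr ⟨d, rfl, hd⟩, hg⟩, hg⟩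

theorem spinWeights_subset_orbit {u : Fin 7 → ℤ} (hu : u ∈ spinWeights) :
    ∃ g ∈ W, ofCoords u = g (ofCoords twoRho) := by
  classical
  by_contra hbad
  obtain ⟨u, hu, hmax⟩ := Finset.exists_max_image
    (spinWeights.toFinset.filter fun u => ¬ ∃ g ∈ W, ofCoords u = g (ofCoords twoRho))
    (fun u => cartanForm twoRho u) ⟨u, by simpa using ⟨hu, by simpa using hbad⟩⟩
  rw [Finset.mem_filter, List.mem_toFinset] at hu
  obtain ⟨hu, hbad⟩ := hu
  obtain ⟨k, hk, rfl⟩ := List.mem_map.mp hu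
  rcases chamber_eq_or_exists_neg k hk with h | ⟨j, hneg, hmem, hval⟩
  · exact hbad ⟨1, W.one_mem, by rw [h]; rfl⟩
  rw [← natCast_zsmul] at hmem
  set u' := chamberTwoRho k - ((2 : ℕ) : ℤ) • signedRoot (k j) with hu'
  by_cases horb : ∃ g ∈ W, ofCoords u' = g (ofCoords twoRho)
  · obtain ⟨g, hg, hgu⟩ := horb
    have hroot := cartanForm_signedRoot k hk j
    obtain ⟨s, hs, hsv⟩ := exists_reflection_mem_W hroot
    refine hbad ⟨s * g, W.mul_mem hs hg, ?_⟩
    rw [LinearEquiv.mul_apply, ← hgu, hsv, ip_ofCoords, hu', cartanForm_comm,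
      cartanForm_sub_zsmul_right, cartanForm_comm, hval, hroot, map_sub, map_zsmul]
    push_cast
    module
  · have := hmax u' (by rw [Finset.mem_filter, List.mem_toFinset]; exact ⟨hmem, horb⟩)
    simp only [hu', cartanForm_sub_zsmul_right, cartanForm_comm twoRho (signedRoot (k j))] at this
    push_cast at this
    linarith

theorem mem_orbit_dominant_iff {v : Fin 8 → ℝ} :
    ((∃ g ∈ W, v = g ((1 / 2 : ℝ) • ofCoords twoRho)) ∧
        ∀ i : Fin 6, 0 < ip v (sroot i.castSucc)) ↔
      ∃ u ∈ spinWeights, v = (1 / 2 : ℝ) • ofCoords u := by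
  have hpos (c : Fin 7 → ℤ) (i : Fin 6) : 0 < ip ((1 / 2 : ℝ) • ofCoords c) (sroot i.castSucc) ↔
      0 < cartanForm c (Pi.single i.castSucc 1) := by
    rw [← ofCoords_single, ip_smul_left, ip_ofCoords]
    simp
  constructor
  · rintro ⟨⟨g, hg, rfl⟩, hdom⟩
    obtain ⟨hip, hlat⟩ := W_preserves hg
    obtain ⟨c, hc⟩ := mem_latQ_iff.mp ((hlat (ofCoords twoRho)).mpr ⟨twoRho, rfl⟩)
    rw [map_smul, hc] at hdom ⊢
    refine ⟨c, mem_spinWeights ?_ (fun d hd => ?_) fun i => (hpos c i).mp (hdom i), rfl⟩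
    · have h := hip (ofCoords twoRho) (ofCoords twoRho)
      rw [hc, ip_ofCoords, ip_ofCoords] at h
      rw [Int.cast_injective h]
      decide
    · obtain ⟨hip', hlat'⟩ := W_preserves (W.inv_mem hg)
      obtain ⟨e, he⟩ := mem_latQ_iff.mp ((hlat' (ofCoords d)).mpr ⟨d, rfl⟩)
      have hed := hip' (ofCoords d) (ofCoords d)
      rw [he, ip_ofCoords, ip_ofCoords, hd] at hed
      have hce := hip' (ofCoords d) (ofCoords c)
      have hginv : g⁻¹ (ofCoords c) = ofCoords twoRho := by
        rw [← hc, ← LinearEquiv.mul_apply, inv_mul_cancel]; rfl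
      rw [he, hginv, ip_ofCoords, ip_ofCoords] at hce
      rw [cartanForm_comm, ← Int.cast_injective hce]
      exact two_le_abs_cartanForm_twoRho (Int.cast_injective hed)
  · rintro ⟨u, hu, rfl⟩
    obtain ⟨g, hg, hgu⟩ := spinWeights_subset_orbit hu
    exact ⟨⟨g, hg, by rw [hgu, map_smul]⟩, fun i => (hpos u i).mpr (spinWeights_dominant u hu i)⟩

@[to_additive]
theorem prod_eq_list_prod_ofCoords {M : Type*} [CommMonoid M] {s : Finset (Fin 8 → ℝ)}
    {l : List (Fin 7 → ℤ)} (hl : l.Nodup) {r : ℝ} (hr : r ≠ 0)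
    (hs : ∀ v, v ∈ s ↔ ∃ c ∈ l, v = r • ofCoords c) (f : (Fin 8 → ℝ) → M) :
    ∏ v ∈ s, f v = (l.map fun c => f (r • ofCoords c)).prod := by
  classical
  have himg : s = l.toFinset.image fun c => r • ofCoords c := by
    ext v
    simp only [hs, Finset.mem_image, List.mem_toFinset, eq_comm]
  rw [himg, Finset.prod_image fun a _ b _ h => ofCoords_injective (smul_right_injective _ hr h),
    List.prod_toFinset _ hl]

end

/-- summing the Weyl dimensions ∏_{α∈Δ⁺(k)} ⟨v,α⟩/⟨ρ_c,α⟩ over the 56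
strictly Δ⁺(k)-dominant vectors v ∈ W·ρ yields 2²⁷ (the dimension of the spin module). -/
theorem e7_spin_module_dimension (sP : Finset (Fin 8 → ℝ))
    (hsP : (sP : Set (Fin 8 → ℝ)) = PhiPos)
    (sK : Finset (Fin 8 → ℝ)) (hsK : (sK : Set (Fin 8 → ℝ)) = PhiPosK)
    (s56 : Finset (Fin 8 → ℝ))
    (hs56 : (s56 : Set (Fin 8 → ℝ)) =
      {v : Fin 8 → ℝ | (∃ g ∈ W, v = g ((1/2 : ℝ) • ∑ x ∈ sP, x)) ∧
        ∀ i : Fin 6, 0 < ip v (sroot i.castSucc)}) :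
    ∑ v ∈ s56, ∏ a ∈ sK, (ip v a / ip ((1/2 : ℝ) • ∑ y ∈ sK, y) a) = 2 ^ 27 := by
  have hP : ∑ x ∈ sP, x = ofCoords twoRho := by
    rw [sum_eq_list_sum_ofCoords nodup_posRoots one_ne_zero
      (fun v => by rw [← Finset.mem_coe, hsP, mem_PhiPos_iff]; simp only [one_smul])
      fun x => x, ← sum_posRoots, map_list_sum]
    simp only [one_smul]
  have hK (v : Fin 8 → ℝ) : v ∈ sK ↔ ∃ c ∈ compactPosRoots, v = (1 : ℝ) • ofCoords c := by
    rw [← Finset.mem_coe, hsK, mem_PhiPosK_iff]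
    simp only [one_smul]
  have hnodup : compactPosRoots.Nodup := nodup_posRoots.filter _
  have hsumK : ∑ x ∈ sK, x = ofCoords compactPosRoots.sum := by
    rw [sum_eq_list_sum_ofCoords hnodup one_ne_zero hK fun x => x, map_list_sum]
    simp only [one_smul]
  have hdiv (l : List (Fin 7 → ℤ)) (f g : (Fin 7 → ℤ) → ℝ) :
      (l.map fun c => f c / g c).prod = (l.map f).prod / (l.map g).prod := by
    simpa using Multiset.prod_map_div (m := (l : Multiset (Fin 7 → ℤ))) (f := f) (g := g)
  have hprod (u : Fin 7 → ℤ) :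
      ∏ a ∈ sK, (ip ((1 / 2 : ℝ) • ofCoords u) a / ip ((1 / 2 : ℝ) • ∑ y ∈ sK, y) a) =
        ((compactPosRoots.map (cartanForm u)).prod : ℝ) /
          (compactPosRoots.map (cartanForm compactPosRoots.sum)).prod := by
    rw [prod_eq_list_prod_ofCoords hnodup one_ne_zero hK, hsumK, Int.cast_list_prod,
      Int.cast_list_prod, List.map_map, List.map_map, ← hdiv]
    congr 1
    refine List.map_congr_left fun c _ => ?_
    rw [one_smul, ip_smul_left, ip_smul_left, ip_ofCoords, ip_ofCoords,
      mul_div_mul_left _ _ (by norm_num)]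
    rfl
  rw [sum_eq_list_sum_ofCoords nodup_spinWeights (by norm_num : (1 / 2 : ℝ) ≠ 0) (fun v => by
    rw [← Finset.mem_coe, hs56, hP]; exact mem_orbit_dominant_iff)]
  simp only [hprod]
  simp only [div_eq_mul_inv, List.sum_map_mul_right]
  rw [← div_eq_mul_inv, div_eq_iff (Int.cast_ne_zero.mpr prod_compact_ne_zero)]
  have h := congrArg (Int.cast : ℤ → ℝ) sum_prod_spinWeights
  rw [Int.cast_list_sum, List.map_map] at h
  rw [Int.cast_mul] at h
  refine Eq.trans h ?_
  norm_num

end E7
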